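/- Let E be a finite-dimensional real normed vector space, Ω ⊆ E a nonempty bounded open convex set, and d_Ω its Hilbert metric. Let c₁ and c₂ be straight geodesics [0, T] → Ω of speeds v₁ ≥ 0 and v₂ ≥ 0 respectively (the speeds need not be equal). Then for all t with 0 ≤ t ≤ T, d_Ω(c₁(t), c₂(t)) ≤ d_Ω(c₁(0), c₂(0)) + d_Ω(c₁(T), c₂(T)). (Crampon's Lemma, Lemma 5.2, whose complete proof is given in the Appendix.) -/

import Mathlib

/-- Affine functions that are strictly positive on `Ω`. -/
def CrPos {E : Type*} [NormedAddCommGroup E] [NormedSpace ℝ E] (Ω : Set E) (f : E → ℝ) : Prop :=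
  (∃ l : E →L[ℝ] ℝ, ∃ c : ℝ, ∀ z, f z = c + l z) ∧ ∀ z ∈ Ω, 0 < f z

/-- `x ≤ m y` in the order of the cone over `Ω`. -/
def CrRel {E : Type*} [NormedAddCommGroup E] [NormedSpace ℝ E] (Ω : Set E) (m : ℝ) (x y : E) :
    Prop := ∀ f, CrPos Ω f → f x ≤ m * f y

/-- The metric hypotheses. -/
def CrHilb {E : Type*} [NormedAddCommGroup E] [NormedSpace ℝ E] (Ω : Set E) (d : E → E → ℝ) :
    Prop := (∀ x ∈ Ω, d x x = 0) ∧
    (∀ x ∈ Ω, ∀ y ∈ Ω, x ≠ y → ∀ a ∈ frontier Ω, ∀ b ∈ frontier Ω,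
      (∃ s > (0 : ℝ), a = x + s • (x - y)) → (∃ t > (0 : ℝ), b = y + t • (y - x)) →
      d x y = (1 / 2) * Real.log ((‖y - a‖ * ‖x - b‖) / (‖x - a‖ * ‖y - b‖)))

/-- interpolation weight -/
noncomputable def crSig (lam A : ℝ) : ℝ := (1 - A ^ lam) / (1 - A)

/-- `x` is the point at fraction `lam` on the straight geodesic from `o` to `x1`. -/
def CrGeo {E : Type*} [NormedAddCommGroup E] [NormedSpace ℝ E] (Ω : Set E) (o x x1 : E)
    (lam A : ℝ) : Prop :=
  0 < A ∧ A ≤ 1 ∧ ∃ h k : ℝ, 0 < h ∧ 0 < k ∧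
    (∀ f, CrPos Ω f → h * f x = (1 - crSig lam A) * f o + crSig lam A * (k * f x1)) ∧
    (∀ f, CrPos Ω f → k * f x1 ≤ f o) ∧ (∀ f, CrPos Ω f → A * f o ≤ k * f x1) ∧
    (∃ f, CrPos Ω f ∧ k * f x1 = f o) ∧ (∃ f, CrPos Ω f ∧ k * f x1 = A * f o)

section cr

variable {E : Type*} [NormedAddCommGroup E] [NormedSpace ℝ E] {Ω : Set E} {d : E → E → ℝ}

theorem CrPos.lin {f : E → ℝ} (hf : CrPos Ω f) (x y : E) (r : ℝ) :
    f (x + r • (y - x)) = f x + r * (f y - f x) := by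
  obtain ⟨⟨l, c, h⟩, -⟩ := hf
  simp only [h, map_add, map_smul, map_sub, smul_eq_mul]; ring

theorem CrPos.frontier_nonneg {f : E → ℝ} (hf : CrPos Ω f) {a : E} (ha : a ∈ frontier Ω) :
    0 ≤ f a := by
  obtain ⟨⟨l, c, h⟩, hp⟩ := hf
  have hc : Continuous f := by
    have : f = fun z => c + l z := funext h
    rw [this]; fun_prop
  have hcl : IsClosed {z | 0 ≤ f z} := isClosed_le continuous_const hc
  exact closure_minimal (fun z hz => (hp z hz).le) hcl (frontier_subset_closure ha)

theorem cr_const : CrPos Ω (fun _ : E => (1 : ℝ)) :=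
  ⟨⟨0, 1, by simp⟩, fun _ _ => one_pos⟩

theorem cr_support (hop : IsOpen Ω) (hconv : Convex ℝ Ω) {a : E} (ha : a ∈ frontier Ω) :
    ∃ f, CrPos Ω f ∧ f a = 0 := by
  have haΩ : a ∉ Ω := by
    rw [hop.frontier_eq] at ha; exact ha.2
  obtain ⟨l, hl⟩ := geometric_hahn_banach_open_point hconv hop haΩ
  refine ⟨fun z => l a + (-l) z, ⟨⟨-l, l a, fun z => rfl⟩, fun z hz => ?_⟩, by simp⟩
  have := hl z hz
  simp only [neg_apply]; linarith

theorem cr_exists_frontier (hop : IsOpen Ω) (hbd : Bornology.IsBounded Ω) {x v : E}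
    (hx : x ∈ Ω) (hv : v ≠ 0) : ∃ s > (0 : ℝ), x + s • v ∈ frontier Ω := by
  obtain ⟨R, hR⟩ := hbd.exists_norm_le
  have hvn : 0 < ‖v‖ := norm_pos_iff.2 hv
  set S := (R + ‖x‖ + 1) / ‖v‖ with hS
  have hR0 : 0 ≤ R := (norm_nonneg x).trans (hR x hx)
  have hS0 : 0 ≤ S := by positivity
  have hout : x + S • v ∉ Ω := by
    intro h
    have h1 := hR _ h
    have h2 : ‖S • v‖ = R + ‖x‖ + 1 := by
      rw [norm_smul, Real.norm_of_nonneg hS0, hS]; field_simp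
    have h3 : ‖S • v‖ ≤ ‖x + S • v‖ + ‖x‖ := by
      have := norm_sub_le (x + S • v) x
      simpa using this
    linarith
  have hpre : IsPreconnected ((fun s : ℝ => x + s • v) '' Set.Icc 0 S) :=
    isPreconnected_Icc.image _ (by fun_prop)
  have : (((fun s : ℝ => x + s • v) '' Set.Icc 0 S) ∩ frontier Ω).Nonempty := by
    by_contra hno
    rw [Set.not_nonempty_iff_eq_empty] at hno
    have hcov : ((fun s : ℝ => x + s • v) '' Set.Icc 0 S) ⊆ Ω ∪ (closure Ω)ᶜ := by
      intro z hz
      by_contra hz'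
      simp only [Set.mem_union, Set.mem_compl_iff, not_or, not_not] at hz'
      have : z ∈ ((fun s : ℝ => x + s • v) '' Set.Icc 0 S) ∩ frontier Ω :=
        ⟨hz, by rw [hop.frontier_eq]; exact ⟨hz'.2, hz'.1⟩⟩
      rw [hno] at this
      exact this
    have hend : x + S • v ∈ ((fun s : ℝ => x + s • v) '' Set.Icc 0 S) := ⟨S, ⟨hS0, le_rfl⟩, rfl⟩
    obtain ⟨z, -, hz1, hz2⟩ := hpre Ω (closure Ω)ᶜ hop isClosed_closure.isOpen_compl hcov
      ⟨x, ⟨0, ⟨le_rfl, hS0⟩, by simp⟩, hx⟩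
      ⟨x + S • v, hend, (hcov hend).resolve_left hout⟩
    exact hz2 (subset_closure hz1)
  obtain ⟨_, ⟨s, hs, rfl⟩, hfr⟩ := this
  refine ⟨s, lt_of_le_of_ne hs.1 ?_, hfr⟩
  rintro rfl
  rw [hop.frontier_eq] at hfr
  exact hfr.2 (by simpa using hx)

theorem cr_formula (hH : CrHilb Ω d) {x y : E} (hx : x ∈ Ω) (hy : y ∈ Ω) (hxy : x ≠ y)
    {s t : ℝ} (hs : 0 < s) (ht : 0 < t) (ha : x + s • (x - y) ∈ frontier Ω)
    (hb : y + t • (y - x) ∈ frontier Ω) :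
    d x y = (1 / 2) * Real.log ((1 + s) / s * ((1 + t) / t)) := by
  rw [hH.2 x hx y hy hxy _ ha _ hb ⟨s, hs, rfl⟩ ⟨t, ht, rfl⟩]
  have hn : 0 < ‖x - y‖ := norm_pos_iff.2 (sub_ne_zero.2 hxy)
  have e1 : ‖y - (x + s • (x - y))‖ = (1 + s) * ‖x - y‖ := by
    have : y - (x + s • (x - y)) = (-(1 + s)) • (x - y) := by module
    rw [this, norm_smul, norm_neg, Real.norm_of_nonneg (by positivity)]
  have e2 : ‖x - (y + t • (y - x))‖ = (1 + t) * ‖x - y‖ := by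
    have : x - (y + t • (y - x)) = (1 + t) • (x - y) := by module
    rw [this, norm_smul, Real.norm_of_nonneg (by positivity)]
  have e3 : ‖x - (x + s • (x - y))‖ = s * ‖x - y‖ := by
    have : x - (x + s • (x - y)) = (-s) • (x - y) := by module
    rw [this, norm_smul, norm_neg, Real.norm_of_nonneg hs.le]
  have e4 : ‖y - (y + t • (y - x))‖ = t * ‖x - y‖ := by
    have : y - (y + t • (y - x)) = t • (x - y) := by module
    rw [this, norm_smul, Real.norm_of_nonneg ht.le]
  rw [e1, e2, e3, e4]
  congr 2
  field_simp

theorem cr_ends (hop : IsOpen Ω) (hbd : Bornology.IsBounded Ω) {x y : E}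
    (hx : x ∈ Ω) (hy : y ∈ Ω) (hxy : x ≠ y) :
    ∃ s t : ℝ, 0 < s ∧ 0 < t ∧ x + s • (x - y) ∈ frontier Ω ∧ y + t • (y - x) ∈ frontier Ω := by
  obtain ⟨s, hs, h1⟩ := cr_exists_frontier hop hbd hx (sub_ne_zero.2 hxy)
  obtain ⟨t, ht, h2⟩ := cr_exists_frontier hop hbd hy (sub_ne_zero.2 hxy.symm)
  exact ⟨s, t, hs, ht, h1, h2⟩

theorem cr_symm (hop : IsOpen Ω) (hbd : Bornology.IsBounded Ω) (hH : CrHilb Ω d) {x y : E}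
    (hx : x ∈ Ω) (hy : y ∈ Ω) : d x y = d y x := by
  by_cases hxy : x = y
  · rw [hxy]
  obtain ⟨s, t, hs, ht, ha, hb⟩ := cr_ends hop hbd hx hy hxy
  rw [cr_formula hH hx hy hxy hs ht ha hb, cr_formula hH hy hx (Ne.symm hxy) ht hs hb ha, mul_comm ((1+s)/s)]

theorem cr_pos (hop : IsOpen Ω) (hbd : Bornology.IsBounded Ω) (hH : CrHilb Ω d) {x y : E}
    (hx : x ∈ Ω) (hy : y ∈ Ω) (hxy : x ≠ y) : 0 < d x y := by
  obtain ⟨s, t, hs, ht, ha, hb⟩ := cr_ends hop hbd hx hy hxy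
  rw [cr_formula hH hx hy hxy hs ht ha hb]
  have h1 : 1 < (1 + s) / s := by rw [lt_div_iff₀ hs]; linarith
  have h2 : 1 < (1 + t) / t := by rw [lt_div_iff₀ ht]; linarith
  have : 1 < (1 + s) / s * ((1 + t) / t) := by nlinarith
  have := Real.log_pos this
  linarith

theorem CrPos.at_a {f : E → ℝ} (hf : CrPos Ω f) (x y : E) (s : ℝ) :
    f (x + s • (x - y)) = (1 + s) * f x - s * f y := by
  have : x + s • (x - y) = x + (-s) • (y - x) := by module
  rw [this, hf.lin]; ring

theorem cr_upper (hop : IsOpen Ω) (hbd : Bornology.IsBounded Ω) (hH : CrHilb Ω d) {x y : E}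
    (hx : x ∈ Ω) (hy : y ∈ Ω) :
    ∃ m n : ℝ, 0 < m ∧ 0 < n ∧ CrRel Ω m x y ∧ CrRel Ω n y x ∧
      d x y = (1 / 2) * Real.log (m * n) := by
  by_cases hxy : x = y
  · subst hxy
    refine ⟨1, 1, one_pos, one_pos, fun f _ => by simp, fun f _ => by simp, ?_⟩
    simp [hH.1 x hx]
  obtain ⟨s, t, hs, ht, ha, hb⟩ := cr_ends hop hbd hx hy hxy
  refine ⟨(1 + t) / t, (1 + s) / s, by positivity, by positivity, fun f hf => ?_, fun f hf => ?_, ?_⟩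
  · have := hf.frontier_nonneg hb
    rw [hf.at_a] at this
    rw [div_mul_eq_mul_div, le_div_iff₀ ht]; linarith
  · have := hf.frontier_nonneg ha
    rw [hf.at_a] at this
    rw [div_mul_eq_mul_div, le_div_iff₀ hs]; linarith
  · rw [cr_formula hH hx hy hxy hs ht ha hb, mul_comm ((1+s)/s)]

theorem cr_lower (hop : IsOpen Ω) (hbd : Bornology.IsBounded Ω) (hconv : Convex ℝ Ω)
    (hH : CrHilb Ω d) {x y : E} (hx : x ∈ Ω) (hy : y ∈ Ω) {m n : ℝ}
    (h1 : CrRel Ω m x y) (h2 : CrRel Ω n y x) : d x y ≤ (1 / 2) * Real.log (m * n) := by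
  by_cases hxy : x = y
  · subst hxy
    have a1 := h1 _ cr_const
    have a2 := h2 _ cr_const
    have := Real.log_nonneg (show 1 ≤ m * n by nlinarith)
    rw [hH.1 x hx]; linarith
  obtain ⟨s, t, hs, ht, ha, hb⟩ := cr_ends hop hbd hx hy hxy
  rw [cr_formula hH hx hy hxy hs ht ha hb]
  have e1 : (1 + s) / s ≤ n := by
    obtain ⟨f, hf, h0⟩ := cr_support hop hconv ha
    rw [hf.at_a] at h0
    have h3 := h2 f hf
    have hp := hf.2 x hx
    have : (1 + s) / s * f x = f y := by field_simp; linarith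
    rw [← this] at h3
    exact le_of_mul_le_mul_right h3 hp
  have e2 : (1 + t) / t ≤ m := by
    obtain ⟨f, hf, h0⟩ := cr_support hop hconv hb
    rw [hf.at_a] at h0
    have h3 := h1 f hf
    have hp := hf.2 y hy
    have : (1 + t) / t * f y = f x := by field_simp; linarith
    rw [← this] at h3
    exact le_of_mul_le_mul_right h3 hp
  have p1 : 0 < (1 + s) / s := by positivity
  have p2 : 0 < (1 + t) / t := by positivity
  have : (1 + s) / s * ((1 + t) / t) ≤ m * n := by nlinarith
  have := Real.log_le_log (by positivity) this
  linarith

theorem cr_triangle (hop : IsOpen Ω) (hbd : Bornology.IsBounded Ω) (hconv : Convex ℝ Ω)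
    (hH : CrHilb Ω d) {x y z : E} (hx : x ∈ Ω) (hy : y ∈ Ω) (hz : z ∈ Ω) :
    d x z ≤ d x y + d y z := by
  obtain ⟨m, n, hm, hn, h1, h2, e⟩ := cr_upper hop hbd hH hx hy
  obtain ⟨m', n', hm', hn', h1', h2', e'⟩ := cr_upper hop hbd hH hy hz
  have := cr_lower hop hbd hconv hH hx hz (m := m * m') (n := n' * n)
    (fun f hf => by
      have := h1 f hf; have := mul_le_mul_of_nonneg_left (h1' f hf) hm.le; linarith)
    (fun f hf => by
      have := h2' f hf; have := mul_le_mul_of_nonneg_left (h2 f hf) hn'.le; linarith)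
  rw [e, e', ← mul_add, ← Real.log_mul (by positivity) (by positivity)]
  rwa [show m * n * (m' * n') = m * m' * (n' * n) by ring]

theorem crSig_nonneg {lam A : ℝ} (hl : 0 ≤ lam) (hA : 0 < A) (hA1 : A ≤ 1) : 0 ≤ crSig lam A :=
  div_nonneg (by linarith [Real.rpow_le_one hA.le hA1 hl]) (by linarith)

theorem crSig_eq {lam A : ℝ} : crSig lam A * (1 - A) = 1 - A ^ lam := by
  unfold crSig
  by_cases h : A = 1
  · subst h; simp
  · exact div_mul_cancel₀ _ (sub_ne_zero.2 (Ne.symm h))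

theorem crSig_le_one {lam A : ℝ} (hl1 : lam ≤ 1) (hA : 0 < A) (hA1 : A ≤ 1) :
    crSig lam A ≤ 1 := by
  refine div_le_one_of_le₀ ?_ (by linarith)
  have := Real.rpow_le_rpow_of_exponent_ge hA hA1 hl1
  rw [Real.rpow_one] at this
  linarith

theorem crSig_anti {lam A B : ℝ} (hl : 0 ≤ lam) (hl1 : lam ≤ 1) (hA : 0 < A) (hAB : A ≤ B)
    (hB : B ≤ 1) : crSig lam B ≤ crSig lam A := by
  rcases hB.eq_or_lt with rfl | hB
  · have := crSig_nonneg hl hA hAB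
    simpa [crSig] using this
  rcases hAB.eq_or_lt with rfl | hAB
  · exact le_rfl
  have hc := Real.concaveOn_rpow hl hl1
  have h := hc.slope_anti_adjacent (x := A) (y := B) (z := 1) hA.le (by simp) hAB hB
  rw [Real.one_rpow] at h
  unfold crSig
  rw [div_le_div_iff₀ (by linarith) (by linarith)] at h ⊢
  nlinarith

theorem cr_core {o x x1 y y1 : E} {lam A B M N : ℝ} (ho : o ∈ Ω) (hx1 : x1 ∈ Ω)
    (hl : 0 ≤ lam) (hl1 : lam ≤ 1)
    (hX : CrGeo Ω o x x1 lam A) (hY : CrGeo Ω o y y1 lam B) (hAB : A ≤ B)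
    (hM : 0 < M) (hN : 0 < N) (h1 : CrRel Ω M x1 y1) (h2 : CrRel Ω N y1 x1) :
    ∃ M' N', CrRel Ω M' x y ∧ CrRel Ω N' y x ∧ M' * N' = M * N := by
  obtain ⟨hA0, hA1, h, k, hh, hk, X1, X2, X3, ⟨fa, hfa, ea⟩, ⟨fb, hfb, eb⟩⟩ := hX
  obtain ⟨hB0, hB1, h', k', hh', hk', Y1, Y2, Y3, -, -⟩ := hY
  have hσ0 := crSig_nonneg hl hA0 hA1
  have hσ1 := crSig_le_one hl1 hA0 hA1
  have hσe := crSig_eq (lam := lam) (A := A)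
  have hτ0 := crSig_nonneg hl hB0 hB1
  have hτ1 := crSig_le_one hl1 hB0 hB1
  have hτe := crSig_eq (lam := lam) (A := B)
  have hτσ := crSig_anti hl hl1 hA0 hAB hB1
  set σ := crSig lam A
  set τ := crSig lam B
  set m := M * k / k' with hm
  set n := N * k' / k with hn
  have m1 : ∀ f, CrPos Ω f → k * f x1 ≤ m * (k' * f y1) := by
    intro f hf
    have := mul_le_mul_of_nonneg_left (h1 f hf) hk.le
    have e : m * (k' * f y1) = k * (M * f y1) := by rw [hm]; field_simp
    rwa [e]
  have n1 : ∀ f, CrPos Ω f → k' * f y1 ≤ n * (k * f x1) := by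
    intro f hf
    have := mul_le_mul_of_nonneg_left (h2 f hf) hk'.le
    have e : n * (k * f x1) = k' * (N * f x1) := by rw [hn]; field_simp
    rwa [e]
  have hm0 : 0 < m := by positivity
  have hn0 : 0 < n := by positivity
  have hm1 : 1 ≤ m := by
    have e1 := m1 fa hfa
    have e2 := mul_le_mul_of_nonneg_left (Y2 fa hfa) hm0.le
    have e3 := hfa.2 o ho
    rw [ea] at e1
    exact le_of_mul_le_mul_right (by linarith) e3
  have hn1 : B ≤ n * A := by
    have e1 := n1 fb hfb
    have e2 := Y3 fb hfb
    have e3 := hfb.2 o ho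
    rw [eb] at e1
    exact le_of_mul_le_mul_right (by linarith) e3
  have key : 1 - τ ≤ n * ((1 - σ) + (σ - τ) * A) := by
    have e1 : (1 - σ) + (σ - τ) * A = A ^ lam - τ * A := by linarith
    rw [e1]
    have e2 : A * B ^ lam ≤ B * A ^ lam := by
      have p1 : A ^ (1 - lam) ≤ B ^ (1 - lam) := Real.rpow_le_rpow hA0.le hAB (by linarith)
      have p2 : A ^ lam * A ^ (1 - lam) = A := by
        rw [← Real.rpow_add hA0]; simp
      have p3 : B ^ lam * B ^ (1 - lam) = B := by
        rw [← Real.rpow_add hB0]; simp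
      have p4 : 0 < A ^ lam := Real.rpow_pos_of_pos hA0 _
      have p5 : 0 < B ^ lam := Real.rpow_pos_of_pos hB0 _
      calc A * B ^ lam = A ^ lam * B ^ lam * A ^ (1 - lam) := by nth_rewrite 1 [← p2]; ring
        _ ≤ A ^ lam * B ^ lam * B ^ (1 - lam) := by gcongr
        _ = A ^ lam * (B ^ lam * B ^ (1 - lam)) := by ring
        _ = B * A ^ lam := by rw [p3]; ring
    have e3 : 0 ≤ A ^ lam - τ * A := by
      have q1 := mul_nonneg (sub_nonneg.2 hτσ) hA0.le
      linarith
    have e4 := mul_le_mul_of_nonneg_right hn1 e3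
    refine le_of_mul_le_mul_left ?_ hA0
    have e5 : A * (1 - τ) = A * B ^ lam - τ * A * B := by
      have : 1 - τ = B ^ lam - τ * B := by linarith
      rw [this]; ring
    linarith
  refine ⟨m * h' / h, n * h / h', fun f hf => ?_, fun f hf => ?_, ?_⟩
  · have g1 := mul_le_mul_of_nonneg_left (m1 f hf) hτ0
    have g2 := mul_nonneg (mul_nonneg (sub_nonneg.2 hm1) (sub_nonneg.2 hτ1)) (hf.2 o ho).le
    have g3 := mul_nonneg (sub_nonneg.2 hτσ) (sub_nonneg.2 (X2 f hf))
    have : h * f x ≤ m * (h' * f y) := by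
      rw [X1 f hf, Y1 f hf]; linarith
    rw [show m * h' / h * f y = (m * (h' * f y)) / h by ring, le_div_iff₀ hh]; linarith
  · have g1 := mul_le_mul_of_nonneg_left (n1 f hf) hτ0
    have g2 := mul_le_mul_of_nonneg_right key (hf.2 o ho).le
    have g3 := mul_le_mul_of_nonneg_left (X3 f hf) (mul_nonneg hn0.le (sub_nonneg.2 hτσ))
    have : h' * f y ≤ n * (h * f x) := by
      rw [X1 f hf, Y1 f hf]; linarith
    rw [show n * h / h' * f x = (n * (h * f x)) / h' by ring, le_div_iff₀ hh']; linarith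
  · rw [hm, hn]; field_simp

/-- logarithmic coordinate on a chord -/
noncomputable def crPhi (s t r : ℝ) : ℝ := Real.log ((r + s) / (1 + t - r))

theorem cr_bounds (hop : IsOpen Ω) (hconv : Convex ℝ Ω) {o x1 : E} (ho : o ∈ Ω) (hx1 : x1 ∈ Ω)
    {s t : ℝ} (hs : 0 < s) (ht : 0 < t) (ha : o + s • (o - x1) ∈ frontier Ω)
    (hb : x1 + t • (x1 - o) ∈ frontier Ω) {r : ℝ} (hr : o + r • (x1 - o) ∈ Ω) :
    0 < r + s ∧ 0 < 1 + t - r := by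
  constructor
  · obtain ⟨f, hf, h0⟩ := cr_support hop hconv ha
    rw [hf.at_a] at h0
    have h1 := hf.2 _ hr
    rw [hf.lin] at h1
    have h2 := hf.2 o ho
    have : s * (f o + r * (f x1 - f o)) = (r + s) * f o := by
      linear_combination (-r) * h0
    have h3 : 0 < (r + s) * f o := by rw [← this]; positivity
    exact pos_of_mul_pos_left h3 h2.le
  · obtain ⟨f, hf, h0⟩ := cr_support hop hconv hb
    rw [hf.at_a] at h0
    have h1 := hf.2 _ hr
    rw [hf.lin] at h1
    have h2 := hf.2 x1 hx1
    have : t * (f o + r * (f x1 - f o)) = (1 + t - r) * f x1 := by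
      linear_combination (r - 1) * h0
    have h3 : 0 < (1 + t - r) * f x1 := by rw [← this]; positivity
    exact pos_of_mul_pos_left h3 h2.le

theorem cr_line_lt (hop : IsOpen Ω) (hconv : Convex ℝ Ω) (hH : CrHilb Ω d)
    {o x1 : E} (ho : o ∈ Ω) (hx1 : x1 ∈ Ω) (hne : o ≠ x1)
    {s t : ℝ} (hs : 0 < s) (ht : 0 < t) (ha : o + s • (o - x1) ∈ frontier Ω)
    (hb : x1 + t • (x1 - o) ∈ frontier Ω) {r r' : ℝ} (hr : o + r • (x1 - o) ∈ Ω)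
    (hr' : o + r' • (x1 - o) ∈ Ω) (hlt : r < r') :
    d (o + r • (x1 - o)) (o + r' • (x1 - o)) = (1 / 2) * (crPhi s t r' - crPhi s t r) := by
  obtain ⟨b1, b2⟩ := cr_bounds hop hconv ho hx1 hs ht ha hb hr
  obtain ⟨b3, b4⟩ := cr_bounds hop hconv ho hx1 hs ht ha hb hr'
  have hδ : 0 < r' - r := sub_pos.2 hlt
  have hδ' : r' - r ≠ 0 := hδ.ne'
  have hxy : o + r • (x1 - o) ≠ o + r' • (x1 - o) := by
    intro h
    have h2 : (r' - r) • (x1 - o) = 0 := by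
      rw [sub_smul, sub_eq_zero]; exact (add_left_cancel h).symm
    rcases smul_eq_zero.1 h2 with h3 | h3
    · exact hδ' h3
    · exact hne (sub_eq_zero.1 h3).symm
  have ea : (o + r • (x1 - o)) + ((r + s) / (r' - r)) •
      ((o + r • (x1 - o)) - (o + r' • (x1 - o))) = o + s • (o - x1) := by
    have : (o + r • (x1 - o)) - (o + r' • (x1 - o)) = (-(r' - r)) • (x1 - o) := by module
    rw [this, smul_smul, show (r + s) / (r' - r) * (-(r' - r)) = -(r + s) by field_simp]
    module
  have eb : (o + r' • (x1 - o)) + ((1 + t - r') / (r' - r)) •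
      ((o + r' • (x1 - o)) - (o + r • (x1 - o))) = x1 + t • (x1 - o) := by
    have : (o + r' • (x1 - o)) - (o + r • (x1 - o)) = (r' - r) • (x1 - o) := by module
    rw [this, smul_smul, show (1 + t - r') / (r' - r) * (r' - r) = (1 + t - r') by field_simp]
    module
  rw [cr_formula hH hr hr' hxy (div_pos b1 hδ) (div_pos b4 hδ) (by rwa [ea]) (by rwa [eb])]
  unfold crPhi
  rw [← Real.log_div (by positivity) (by positivity)]
  congr 2
  have e1 : 1 + (r + s) / (r' - r) = (r' + s) / (r' - r) := by field_simp; ring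
  have e2 : 1 + (1 + t - r') / (r' - r) = (1 + t - r) / (r' - r) := by field_simp; ring
  rw [e1, e2]
  field_simp

theorem cr_line (hop : IsOpen Ω) (hbd : Bornology.IsBounded Ω) (hconv : Convex ℝ Ω)
    (hH : CrHilb Ω d)
    {o x1 : E} (ho : o ∈ Ω) (hx1 : x1 ∈ Ω) (hne : o ≠ x1)
    {s t : ℝ} (hs : 0 < s) (ht : 0 < t) (ha : o + s • (o - x1) ∈ frontier Ω)
    (hb : x1 + t • (x1 - o) ∈ frontier Ω) {r r' : ℝ} (hr : o + r • (x1 - o) ∈ Ω)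
    (hr' : o + r' • (x1 - o) ∈ Ω) :
    d (o + r • (x1 - o)) (o + r' • (x1 - o)) = (1 / 2) * |crPhi s t r' - crPhi s t r| := by
  have hnn : ∀ p ∈ Ω, ∀ q ∈ Ω, 0 ≤ d p q := by
    intro p hp q hq
    by_cases h : p = q
    · rw [h, hH.1 q hq]
    · exact (cr_pos hop hbd hH hp hq h).le
  rcases lt_trichotomy r r' with h | h | h
  · have e := cr_line_lt hop hconv hH ho hx1 hne hs ht ha hb hr hr' h
    have := hnn _ hr _ hr'
    rw [abs_of_nonneg (by linarith), e]
  · subst h; simp [hH.1 _ hr]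
  · have e := cr_line_lt hop hconv hH ho hx1 hne hs ht ha hb hr' hr h
    have := hnn _ hr' _ hr
    rw [cr_symm hop hbd hH hr hr', abs_sub_comm, abs_of_nonneg (by linarith), e]

theorem cr_geo (hop : IsOpen Ω) (hbd : Bornology.IsBounded Ω) (hconv : Convex ℝ Ω)
    (hH : CrHilb Ω d) {o x x1 : E} (ho : o ∈ Ω) (hx : x ∈ Ω) (hx1 : x1 ∈ Ω) {lam V : ℝ}
    (hl : 0 ≤ lam) (hl1 : lam ≤ 1) (hV : d o x1 = V) (h1 : d o x = lam * V)
    (h2 : d x x1 = (1 - lam) * V) (hcol : o ≠ x1 → ∃ r : ℝ, x = o + r • (x1 - o)) :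
    CrGeo Ω o x x1 lam (Real.exp (-2 * V)) := by
  by_cases hne : o = x1
  · subst hne
    have hV0 : V = 0 := by rw [← hV, hH.1 o ho]
    have hxo : o = x := by
      by_contra h
      have := cr_pos hop hbd hH ho hx h
      rw [h1, hV0] at this
      simp at this
    subst hxo
    subst hV0
    refine ⟨by simp, by simp, 1, 1, one_pos, one_pos, fun f _ => by ring, fun f _ => by simp,
      fun f _ => by simp, ⟨_, cr_const, by simp⟩, ⟨_, cr_const, by simp⟩⟩
  obtain ⟨s, t, hs, ht, ha, hb⟩ := cr_ends hop hbd ho hx1 hne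
  obtain ⟨r, rfl⟩ := hcol hne
  obtain ⟨b1, b2⟩ := cr_bounds hop hconv ho hx1 hs ht ha hb hx
  have z0 : o + (0 : ℝ) • (x1 - o) = o := by simp
  have z1 : o + (1 : ℝ) • (x1 - o) = x1 := by simp
  have m0 : o + (0 : ℝ) • (x1 - o) ∈ Ω := by rwa [z0]
  have m1 : o + (1 : ℝ) • (x1 - o) ∈ Ω := by rwa [z1]
  have VP : 0 < V := by rw [← hV]; exact cr_pos hop hbd hH ho hx1 hne
  have k1 := cr_line_lt hop hconv hH ho hx1 hne hs ht ha hb m0 m1 one_pos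
  have k2 := cr_line hop hbd hconv hH ho hx1 hne hs ht ha hb m0 hx
  have k3 := cr_line hop hbd hconv hH ho hx1 hne hs ht ha hb hx m1
  rw [z0, z1, hV] at k1
  rw [z0, h1] at k2
  rw [z1, h2] at k3
  have hφ : crPhi s t r = crPhi s t 0 + 2 * lam * V := by
    rcases abs_cases (crPhi s t r - crPhi s t 0) with ⟨e, -⟩ | ⟨e, -⟩ <;>
    rcases abs_cases (crPhi s t 1 - crPhi s t r) with ⟨e', -⟩ | ⟨e', -⟩ <;>
    rw [e] at k2 <;> rw [e'] at k3 <;> nlinarith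
  have hφ1 : crPhi s t 1 = crPhi s t 0 + 2 * V := by linarith
  have hA0 : 0 < Real.exp (-2 * V) := Real.exp_pos _
  have hA1 : Real.exp (-2 * V) < 1 := by rw [Real.exp_lt_one_iff]; linarith
  have E0 : Real.exp (crPhi s t 0) = s / (1 + t) := by
    unfold crPhi; rw [Real.exp_log (by simp; positivity)]; simp
  have E1 : Real.exp (crPhi s t 1) = (1 + s) / t := by
    unfold crPhi
    rw [show 1 + t - 1 = t by ring, Real.exp_log (by positivity)]
  have Er : Real.exp (crPhi s t r) = (r + s) / (1 + t - r) := by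
    unfold crPhi; rw [Real.exp_log (by positivity)]
  have eA : s * t = (1 + s) * (1 + t) * Real.exp (-2 * V) := by
    have : Real.exp (crPhi s t 0) = Real.exp (crPhi s t 1) * Real.exp (-2 * V) := by
      rw [← Real.exp_add, hφ1]; congr 1; ring
    rw [E0, E1] at this
    field_simp at this
    rw [show -(2 * V) = -2 * V by ring] at this
    linarith
  have eE : (1 + t - r) * s = (r + s) * (1 + t) * Real.exp (-2 * V) ^ lam := by
    have : Real.exp (crPhi s t 0) = Real.exp (crPhi s t r) * Real.exp (-2 * V) ^ lam := by
      rw [← Real.exp_mul, ← Real.exp_add, hφ]; congr 1; ring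
    rw [E0, Er] at this
    field_simp at this
    rw [show -(2 * V) = -2 * V by ring] at this
    linarith
  have hσ : crSig lam (Real.exp (-2 * V)) = r * (1 + s) / (r + s) := by
    unfold crSig
    rw [div_eq_div_iff (by linarith) b1.ne']
    refine mul_left_cancel₀ (show (1 + t) ≠ 0 by positivity) ?_
    linear_combination (1 : ℝ) * eE - r * eA
  generalize Real.exp (-2 * V) = A at *
  refine ⟨hA0, hA1.le, s / (r + s), s / (1 + s), by positivity, by positivity, ?_, ?_, ?_, ?_, ?_⟩
  · intro f hf
    rw [hσ, hf.lin]
    field_simp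
    ring
  · intro f hf
    have := hf.frontier_nonneg ha
    rw [hf.at_a] at this
    rw [div_mul_eq_mul_div, div_le_iff₀ (by positivity)]; linarith
  · intro f hf
    have := hf.frontier_nonneg hb
    rw [hf.at_a] at this
    rw [div_mul_eq_mul_div, le_div_iff₀ (by positivity)]
    refine le_of_mul_le_mul_left ?_ (show 0 < 1 + t by positivity)
    have e : (1 + t) * (A * f o * (1 + s)) = s * t * f o := by rw [eA]; ring
    rw [e]
    nlinarith
  · obtain ⟨f, hf, h0⟩ := cr_support hop hconv ha
    rw [hf.at_a] at h0
    refine ⟨f, hf, ?_⟩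
    field_simp; linarith
  · obtain ⟨f, hf, h0⟩ := cr_support hop hconv hb
    rw [hf.at_a] at h0
    refine ⟨f, hf, ?_⟩
    rw [div_mul_eq_mul_div, div_eq_iff (by positivity)]
    refine mul_left_cancel₀ (show (1 + t) ≠ 0 by positivity) ?_
    linear_combination s * h0 + f o * eA

theorem cr_exists (hop : IsOpen Ω) (hbd : Bornology.IsBounded Ω) (hconv : Convex ℝ Ω)
    (hH : CrHilb Ω d) {o x1 : E} (ho : o ∈ Ω) (hx1 : x1 ∈ Ω) {lam : ℝ}
    (hl : 0 ≤ lam) (hl1 : lam ≤ 1) :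
    ∃ x ∈ Ω, d o x = lam * d o x1 ∧ d x x1 = (1 - lam) * d o x1 ∧
      ∃ r : ℝ, x = o + r • (x1 - o) := by
  by_cases hne : o = x1
  · subst hne
    exact ⟨o, ho, by simp [hH.1 o ho], by simp [hH.1 o ho], 0, by simp⟩
  obtain ⟨s, t, hs, ht, ha, hb⟩ := cr_ends hop hbd ho hx1 hne
  have z0 : o + (0 : ℝ) • (x1 - o) = o := by simp
  have z1 : o + (1 : ℝ) • (x1 - o) = x1 := by simp
  have m0 : o + (0 : ℝ) • (x1 - o) ∈ Ω := by rwa [z0]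
  have m1 : o + (1 : ℝ) • (x1 - o) ∈ Ω := by rwa [z1]
  have k1 := cr_line_lt hop hconv hH ho hx1 hne hs ht ha hb m0 m1 one_pos
  rw [z0, z1] at k1
  have VP := cr_pos hop hbd hH ho hx1 hne
  set V := d o x1
  set q := s / (1 + t) * Real.exp (2 * lam * V) with hq
  have E0 : Real.exp (crPhi s t 0) = s / (1 + t) := by
    unfold crPhi; rw [Real.exp_log (by simp; positivity)]; simp
  have E1 : Real.exp (crPhi s t 1) = (1 + s) / t := by
    unfold crPhi
    rw [show 1 + t - 1 = t by ring, Real.exp_log (by positivity)]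
  have hq0 : 0 < q := by positivity
  have hq1 : s / (1 + t) ≤ q := by
    rw [hq]; exact le_mul_of_one_le_right (by positivity) (Real.one_le_exp (by positivity))
  have hq2 : q ≤ (1 + s) / t := by
    rw [hq, ← E0, ← E1, ← Real.exp_add, Real.exp_le_exp]
    nlinarith
  rw [div_le_iff₀ (by positivity)] at hq1
  rw [le_div_iff₀ ht] at hq2
  set r := (q * (1 + t) - s) / (1 + q) with hr
  have r0 : 0 ≤ r := div_nonneg (by linarith) (by positivity)
  have r1 : r ≤ 1 := div_le_one_of_le₀ (by linarith) (by positivity)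
  have hx : o + r • (x1 - o) ∈ Ω := hconv.add_smul_sub_mem ho hx1 ⟨r0, r1⟩
  obtain ⟨b1, b2⟩ := cr_bounds hop hconv ho hx1 hs ht ha hb hx
  have hφ : crPhi s t r = crPhi s t 0 + 2 * lam * V := by
    have : (r + s) / (1 + t - r) = q := by
      rw [div_eq_iff b2.ne', hr]; field_simp; ring
    have e : crPhi s t r = Real.log q := by unfold crPhi; rw [this]
    rw [e, hq, ← E0, ← Real.exp_add, Real.log_exp]
  have k2 := cr_line hop hbd hconv hH ho hx1 hne hs ht ha hb m0 hx
  have k3 := cr_line hop hbd hconv hH ho hx1 hne hs ht ha hb hx m1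
  rw [z0] at k2
  rw [z1] at k3
  refine ⟨_, hx, ?_, ?_, r, rfl⟩
  · have : 0 ≤ lam * V := by positivity
    rw [k2, hφ, abs_of_nonneg (by linarith)]; ring
  · have : 0 ≤ (1 - lam) * V := mul_nonneg (by linarith) VP.le
    have e : crPhi s t 1 - crPhi s t r = 2 * ((1 - lam) * V) := by rw [hφ]; linarith
    rw [k3, e, abs_of_nonneg (by linarith)]; ring

theorem cr_same (hop : IsOpen Ω) (hbd : Bornology.IsBounded Ω) (hconv : Convex ℝ Ω)
    (hH : CrHilb Ω d) {o x x1 y y1 : E} (ho : o ∈ Ω) (hx : x ∈ Ω) (hx1 : x1 ∈ Ω)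
    (hy : y ∈ Ω) (hy1 : y1 ∈ Ω) {lam A B : ℝ}
    (hl : 0 ≤ lam) (hl1 : lam ≤ 1)
    (hX : CrGeo Ω o x x1 lam A) (hY : CrGeo Ω o y y1 lam B) : d x y ≤ d x1 y1 := by
  obtain ⟨m, n, hm, hn, g1, g2, e⟩ := cr_upper hop hbd hH hx1 hy1
  rw [e]
  rcases le_total A B with hAB | hAB
  · obtain ⟨M, N, w1, w2, w3⟩ := cr_core ho hx1 hl hl1 hX hY hAB hm hn g1 g2
    rw [← w3]
    exact cr_lower hop hbd hconv hH hx hy w1 w2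
  · obtain ⟨M, N, w1, w2, w3⟩ := cr_core ho hy1 hl hl1 hY hX hAB hn hm g2 g1
    rw [mul_comm, mul_comm m, ← w3, mul_comm M, mul_comm]
    exact cr_lower hop hbd hconv hH hx hy w2 w1

theorem cr_col {T t : ℝ} {c : ℝ → E} (hT : 0 ≤ T) (ht : t ∈ Set.Icc (0 : ℝ) T)
    (hline : ∃ p q : E, ∀ t ∈ Set.Icc (0 : ℝ) T, ∃ r : ℝ, c t = p + r • q)
    (hne : c 0 ≠ c T) : ∃ r : ℝ, c t = c 0 + r • (c T - c 0) := by
  obtain ⟨p, q, h⟩ := hline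
  obtain ⟨a, ha⟩ := h 0 ⟨le_rfl, hT⟩
  obtain ⟨b, hb⟩ := h T ⟨hT, le_rfl⟩
  obtain ⟨r, hr⟩ := h t ht
  have hab : b - a ≠ 0 := by
    intro h0
    apply hne
    rw [ha, hb, sub_eq_zero.1 h0]
  refine ⟨(r - a) / (b - a), ?_⟩
  rw [ha, hb, hr]
  have : p + b • q - (p + a • q) = (b - a) • q := by module
  rw [this, smul_smul, div_mul_cancel₀ _ hab]
  module

end cr


/-- Crampon's Lemma (Lemma 5.2): for two straight geodesics `c₁, c₂ : [0, T] → Ω` with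
constant (possibly different) speeds, and every `0 ≤ t ≤ T`,
`d_Ω(c₁(t), c₂(t)) ≤ d_Ω(c₁(0), c₂(0)) + d_Ω(c₁(T), c₂(T))`. -/
theorem crampon_lemma {E : Type*} [NormedAddCommGroup E] [NormedSpace ℝ E]
    [FiniteDimensional ℝ E]
    (Ω : Set E) (hne : Ω.Nonempty) (hbd : Bornology.IsBounded Ω)
    (hop : IsOpen Ω) (hconv : Convex ℝ Ω)
    (d : E → E → ℝ)
    (hd0 : ∀ x ∈ Ω, d x x = 0)
    (hd : ∀ x ∈ Ω, ∀ y ∈ Ω, x ≠ y → ∀ a ∈ frontier Ω, ∀ b ∈ frontier Ω,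
      (∃ s > (0 : ℝ), a = x + s • (x - y)) → (∃ t > (0 : ℝ), b = y + t • (y - x)) →
      d x y = (1 / 2) * Real.log ((‖y - a‖ * ‖x - b‖) / (‖x - a‖ * ‖y - b‖)))
    (T : ℝ) (hT : 0 ≤ T)
    (c₁ c₂ : ℝ → E) (v₁ v₂ : ℝ) (hv₁ : 0 ≤ v₁) (hv₂ : 0 ≤ v₂)
    (hc₁Ω : ∀ t ∈ Set.Icc (0 : ℝ) T, c₁ t ∈ Ω)
    (hc₂Ω : ∀ t ∈ Set.Icc (0 : ℝ) T, c₂ t ∈ Ω)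
    (hline₁ : ∃ p q : E, ∀ t ∈ Set.Icc (0 : ℝ) T, ∃ r : ℝ, c₁ t = p + r • q)
    (hline₂ : ∃ p q : E, ∀ t ∈ Set.Icc (0 : ℝ) T, ∃ r : ℝ, c₂ t = p + r • q)
    (hgeo₁ : ∀ s ∈ Set.Icc (0 : ℝ) T, ∀ t ∈ Set.Icc (0 : ℝ) T,
      d (c₁ s) (c₁ t) = v₁ * |s - t|)
    (hgeo₂ : ∀ s ∈ Set.Icc (0 : ℝ) T, ∀ t ∈ Set.Icc (0 : ℝ) T,
      d (c₂ s) (c₂ t) = v₂ * |s - t|)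
    (t : ℝ) (ht : t ∈ Set.Icc (0 : ℝ) T) :
    d (c₁ t) (c₂ t) ≤ d (c₁ 0) (c₂ 0) + d (c₁ T) (c₂ T) := by
  have hH : CrHilb Ω d := ⟨hd0, hd⟩
  have m0 : (0 : ℝ) ∈ Set.Icc (0 : ℝ) T := ⟨le_rfl, hT⟩
  have mT : T ∈ Set.Icc (0 : ℝ) T := ⟨hT, le_rfl⟩
  have hl : 0 ≤ t / T := div_nonneg ht.1 hT
  have hl1 : t / T ≤ 1 := div_le_one_of_le₀ ht.2 hT
  have hlT : t / T * T = t := by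
    rcases hT.eq_or_lt with h | h
    · have h2 := ht.1
      have h3 := ht.2
      rw [← h] at h3 ⊢
      simp only [mul_zero]
      linarith
    · field_simp
  have hx0 := hc₁Ω 0 m0
  have hxT := hc₁Ω T mT
  have hxt := hc₁Ω t ht
  have hy0 := hc₂Ω 0 m0
  have hyT := hc₂Ω T mT
  have hyt := hc₂Ω t ht
  have a0 : |(0 : ℝ) - t| = t := by rw [zero_sub, abs_neg, abs_of_nonneg ht.1]
  have aT : |t - T| = T - t := by rw [abs_sub_comm, abs_of_nonneg (by linarith [ht.2])]
  have aTT : |(0 : ℝ) - T| = T := by rw [zero_sub, abs_neg, abs_of_nonneg hT]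
  set lam := t / T
  obtain ⟨z, hz, z1, z2, r, hr⟩ := cr_exists hop hbd hconv hH hx0 hyT hl hl1
  -- geodesic c₁ from its origin
  have G1 := cr_geo hop hbd hconv hH hx0 hxt hxT hl hl1 rfl
    (by rw [hgeo₁ 0 m0 t ht, hgeo₁ 0 m0 T mT, a0, aTT]
        linear_combination (-v₁) * hlT)
    (by rw [hgeo₁ t ht T mT, hgeo₁ 0 m0 T mT, aT, aTT]
        linear_combination v₁ * hlT)
    (cr_col hT ht hline₁)
  have G3 := cr_geo hop hbd hconv hH hx0 hz hyT hl hl1 rfl z1 z2 (fun _ => ⟨r, hr⟩)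
  -- reversed geodesics
  have G2 := cr_geo hop hbd hconv hH hyT hyt hy0 (lam := 1 - lam) (by linarith) (by linarith) rfl
    (by rw [hgeo₂ T mT t ht, hgeo₂ T mT 0 m0, abs_sub_comm, aT, abs_sub_comm T 0, aTT]
        linear_combination v₂ * hlT)
    (by rw [hgeo₂ t ht 0 m0, hgeo₂ T mT 0 m0, abs_sub_comm, a0, abs_sub_comm T 0, aTT]
        linear_combination (-v₂) * hlT)
    (fun hne => by
      obtain ⟨r', hr'⟩ := cr_col hT ht hline₂ hne.symm
      exact ⟨1 - r', by rw [hr']; module⟩)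
  have G4 := cr_geo hop hbd hconv hH hyT hz hx0 (lam := 1 - lam) (by linarith) (by linarith) rfl
    (by rw [cr_symm hop hbd hH hyT hz, cr_symm hop hbd hH hyT hx0, z2])
    (by rw [cr_symm hop hbd hH hz hx0, cr_symm hop hbd hH hyT hx0, z1]; ring)
    (fun _ => ⟨1 - r, by rw [hr]; module⟩)
  have e1 := cr_same hop hbd hconv hH hx0 hxt hxT hz hyT hl hl1 G1 G3
  have e2 := cr_same hop hbd hconv hH hyT hz hx0 hyt hy0 (lam := 1 - lam) (by linarith)
    (by linarith) G4 G2
  have e3 := cr_triangle hop hbd hconv hH hxt hz hyt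
  linarith
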